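/- Let P be a Borel probability measure on ℝ^d, the law of a random vector X with E‖X‖ < ∞, and let δ > 0. Then there exist constants 0 < c_1 < c_2 such that c_1 ‖z‖^{-1} ≤ D_δ(z|P) ≤ c_2 ‖z‖^{-1} for all z ∈ ℝ^d with ‖z‖ sufficiently large; i.e., the distributionally robust halfspace depth decays linearly at infinity. -/

import Mathlib

open MeasureTheory RealInnerProductSpace
open scoped ENNReal

abbrev Ed (d : ℕ) := EuclideanSpace ℝ (Fin d)

/-- 1-Wasserstein distance between Borel measures on `ℝ^d`. -/
noncomputable def wassersteinDist {d : ℕ} (P Q : Measure (Ed d)) : ℝ≥0∞ :=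
  ⨅ (π : Measure (Ed d × Ed d)) (_ : π.map Prod.fst = P) (_ : π.map Prod.snd = Q),
    ∫⁻ p, ENNReal.ofReal ‖p.1 - p.2‖ ∂π

/-- Worst-case probability of a set over the Wasserstein ball of radius `δ` around `P`. -/
noncomputable def supProb {d : ℕ} (δ : ℝ) (P : Measure (Ed d)) (A : Set (Ed d)) : ℝ :=
  sSup {v : ℝ | ∃ Q : Measure (Ed d), IsProbabilityMeasure Q ∧
    wassersteinDist Q P ≤ ENNReal.ofReal δ ∧ v = (Q A).toReal}

/-- Distributionally robust halfspace depth. -/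
noncomputable def robustDepth {d : ℕ} (δ : ℝ) (z : Ed d) (P : Measure (Ed d)) : ℝ :=
  sInf {v : ℝ | ∃ u : Ed d, ‖u‖ = 1 ∧ v = supProb δ P {x | 0 ≤ ⟪u, x - z⟫}}

theorem lintegral_enorm_le_add_wassersteinDist {d : ℕ} (Q P : Measure (Ed d)) :
    ∫⁻ x, ‖x‖ₑ ∂Q ≤ wassersteinDist Q P + ∫⁻ x, ‖x‖ₑ ∂P := by
  unfold wassersteinDist
  simp only [ENNReal.iInf_add]
  refine le_iInf fun π => le_iInf fun h₁ => le_iInf fun h₂ => ?_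
  rw [← h₁, ← h₂, lintegral_map (by fun_prop) measurable_fst,
    lintegral_map (by fun_prop) measurable_snd, ← lintegral_add_right _ (by fun_prop)]
  refine lintegral_mono fun p => ?_
  rw [ofReal_norm]
  simpa using enorm_add_le (p.1 - p.2) p.2

theorem measure_halfspace_le {d : ℕ} (Q P : Measure (Ed d)) [IsProbabilityMeasure Q]
    (hint : Integrable (fun x : Ed d => ‖x‖) P) {δ : ℝ} (hδ : 0 ≤ δ)
    (hQ : wassersteinDist Q P ≤ ENNReal.ofReal δ) {u z : Ed d} (hu : ‖u‖ = 1) (hz : 0 < ⟪u, z⟫) :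
    (Q {x | 0 ≤ ⟪u, x - z⟫}).toReal ≤ (δ + ∫ x, ‖x‖ ∂P) * ⟪u, z⟫⁻¹ := by
  have hP : ∫⁻ x, ‖x‖ₑ ∂P = ENNReal.ofReal (∫ x, ‖x‖ ∂P) :=
    (ofReal_integral_norm_eq_lintegral_enorm
      ((integrable_norm_iff (by fun_prop)).1 hint)).symm
  have hE : 0 ≤ ∫ x, ‖x‖ ∂P := integral_nonneg fun _ => norm_nonneg _
  have hQE : ∫⁻ x, ‖x‖ₑ ∂Q ≤ ENNReal.ofReal (δ + ∫ x, ‖x‖ ∂P) := by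
    refine (lintegral_enorm_le_add_wassersteinDist Q P).trans ?_
    rw [hP, ENNReal.ofReal_add hδ hE]
    gcongr
  have hsub : {x | 0 ≤ ⟪u, x - z⟫} ⊆ {x : Ed d | ENNReal.ofReal ⟪u, z⟫ ≤ ‖x‖ₑ} := by
    intro x hx
    simp only [Set.mem_ofPred_eq, inner_sub_right, sub_nonneg] at hx ⊢
    rw [← ofReal_norm]
    refine ENNReal.ofReal_le_ofReal (hx.trans ?_)
    simpa [hu] using real_inner_le_norm u x
  have hmul : ENNReal.ofReal ⟪u, z⟫ * Q {x | 0 ≤ ⟪u, x - z⟫} ≤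
      ENNReal.ofReal (δ + ∫ x, ‖x‖ ∂P) :=
    (mul_le_mul_right (measure_mono hsub) _).trans
      ((mul_meas_ge_le_lintegral (by fun_prop) _).trans hQE)
  have hreal := ENNReal.toReal_mono ENNReal.ofReal_ne_top hmul
  rw [ENNReal.toReal_mul, ENNReal.toReal_ofReal hz.le, ENNReal.toReal_ofReal (add_nonneg hδ hE)]
    at hreal
  rwa [← div_eq_mul_inv, le_div_iff₀ hz, mul_comm]

theorem wassersteinDist_mixture_dirac_le {d : ℕ} (P : Measure (Ed d)) [IsProbabilityMeasure P]
    (z : Ed d) {s t : ℝ≥0∞} (hst : s + t = 1) :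
    wassersteinDist (s • P + t • Measure.dirac z) P ≤ t * (‖z‖ₑ + ∫⁻ x, ‖x‖ₑ ∂P) := by
  have hdiag : Measurable fun x : Ed d => (x, x) := by fun_prop
  have hconst : Measurable fun x : Ed d => (z, x) := by fun_prop
  unfold wassersteinDist
  refine (iInf_le _ (s • P.map (fun x => (x, x)) + t • P.map (fun x => (z, x)))).trans ?_
  refine (iInf_le _ ?_).trans ((iInf_le _ ?_).trans ?_)
  · rw [Measure.map_add _ _ measurable_fst, Measure.map_smul, Measure.map_smul,
      Measure.map_map measurable_fst hdiag, Measure.map_map measurable_fst hconst]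
    simp [Function.comp_def]
  · rw [Measure.map_add _ _ measurable_snd, Measure.map_smul, Measure.map_smul,
      Measure.map_map measurable_snd hdiag, Measure.map_map measurable_snd hconst]
    simp [Function.comp_def, ← add_smul, hst]
  · rw [lintegral_add_measure, lintegral_smul_measure, lintegral_smul_measure,
      lintegral_map (by fun_prop) hdiag, lintegral_map (by fun_prop) hconst]
    simp only [sub_self, norm_zero, ENNReal.ofReal_zero, lintegral_zero, smul_eq_mul, mul_zero,
      zero_add, ofReal_norm]
    gcongr
    calc ∫⁻ x, ‖z - x‖ₑ ∂P ≤ ∫⁻ x, (‖z‖ₑ + ‖x‖ₑ) ∂P := lintegral_mono fun x => enorm_sub_le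
      _ = ‖z‖ₑ + ∫⁻ x, ‖x‖ₑ ∂P := by
        rw [lintegral_add_left measurable_const]
        simp

theorem div_le_supProb {d : ℕ} (P : Measure (Ed d)) [IsProbabilityMeasure P]
    (hint : Integrable (fun x : Ed d => ‖x‖) P) {δ : ℝ} (hδ : 0 < δ) {z : Ed d} {A : Set (Ed d)}
    (hz : z ∈ A) : δ / (‖z‖ + (∫ x, ‖x‖ ∂P) + δ) ≤ supProb δ P A := by
  have hE : 0 ≤ ∫ x, ‖x‖ ∂P := integral_nonneg fun _ => norm_nonneg _
  have hP : ∫⁻ x, ‖x‖ₑ ∂P = ENNReal.ofReal (∫ x, ‖x‖ ∂P) :=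
    (ofReal_integral_norm_eq_lintegral_enorm
      ((integrable_norm_iff (by fun_prop)).1 hint)).symm
  have hz0 := norm_nonneg z
  generalize (∫ x, ‖x‖ ∂P) = E at hE hP ⊢
  set ε := δ / (‖z‖ + E + δ) with hε
  have hε0 : 0 ≤ ε := by positivity
  have hε1 : ε ≤ 1 := by
    rw [hε, div_le_one (by positivity)]
    linarith
  have hsum : ENNReal.ofReal (1 - ε) + ENNReal.ofReal ε = 1 := by
    rw [← ENNReal.ofReal_add (by linarith) hε0]
    simp
  set Q := ENNReal.ofReal (1 - ε) • P + ENNReal.ofReal ε • Measure.dirac z with hQ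
  have hprob : IsProbabilityMeasure Q := ⟨by simp [hQ, hsum]⟩
  have hdist : wassersteinDist Q P ≤ ENNReal.ofReal δ := by
    refine (wassersteinDist_mixture_dirac_le P z hsum).trans ?_
    rw [hP, ← ofReal_norm, ← ENNReal.ofReal_add hz0 hE, ← ENNReal.ofReal_mul hε0]
    refine ENNReal.ofReal_le_ofReal ?_
    rw [hε, div_mul_eq_mul_div, div_le_iff₀ (by positivity)]
    nlinarith
  have hmass : ENNReal.ofReal ε ≤ Q A := by
    simp [hQ, Measure.dirac_apply_of_mem hz]
  have hbdd : BddAbove {v : ℝ | ∃ Q : Measure (Ed d), IsProbabilityMeasure Q ∧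
      wassersteinDist Q P ≤ ENNReal.ofReal δ ∧ v = (Q A).toReal} := by
    refine ⟨1, ?_⟩
    rintro v ⟨Q', _, -, rfl⟩
    exact measureReal_le_one
  refine le_trans ?_ (le_csSup hbdd ⟨Q, hprob, hdist, rfl⟩)
  exact (ENNReal.ofReal_le_iff_le_toReal (measure_ne_top Q A)).1 hmass

theorem supProb_halfspace_le {d : ℕ} (P : Measure (Ed d))
    (hint : Integrable (fun x : Ed d => ‖x‖) P) {δ : ℝ} (hδ : 0 ≤ δ) {u z : Ed d}
    (hu : ‖u‖ = 1) (hz : 0 < ⟪u, z⟫) :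
    supProb δ P {x | 0 ≤ ⟪u, x - z⟫} ≤ (δ + ∫ x, ‖x‖ ∂P) * ⟪u, z⟫⁻¹ := by
  have hE : 0 ≤ ∫ x, ‖x‖ ∂P := integral_nonneg fun _ => norm_nonneg _
  refine Real.sSup_le ?_ (mul_nonneg (add_nonneg hδ hE) (inv_nonneg.2 hz.le))
  rintro v ⟨Q, _, hQ, rfl⟩
  exact measure_halfspace_le Q P hint hδ hQ hu hz

theorem supProb_nonneg {d : ℕ} (δ : ℝ) (P : Measure (Ed d)) (A : Set (Ed d)) :
    0 ≤ supProb δ P A := by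
  refine Real.sSup_nonneg ?_
  rintro v ⟨Q, -, -, rfl⟩
  exact ENNReal.toReal_nonneg

/-- **Linear decay.** If `E‖X‖ < ∞` then for `δ > 0` there are constants `0 < c₁ < c₂`
with `c₁ ‖z‖⁻¹ ≤ D_δ(z|P) ≤ c₂ ‖z‖⁻¹` for all `z` with `‖z‖` large enough. -/
theorem robustDepth_linear_decay {d : ℕ} (P : Measure (Ed d)) [IsProbabilityMeasure P]
    (hint : Integrable (fun x : Ed d => ‖x‖) P) (δ : ℝ) (hδ : 0 < δ) :
    ∃ c₁ c₂ : ℝ, 0 < c₁ ∧ c₁ < c₂ ∧ ∃ R : ℝ, ∀ z : Ed d, R ≤ ‖z‖ →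
      c₁ * ‖z‖⁻¹ ≤ robustDepth δ z P ∧ robustDepth δ z P ≤ c₂ * ‖z‖⁻¹ := by
  have hE : 0 ≤ ∫ x, ‖x‖ ∂P := integral_nonneg fun _ => norm_nonneg _
  have hlower {z : Ed d} {A : Set (Ed d)} (hz : z ∈ A) := div_le_supProb P hint hδ hz
  have hupper {u z : Ed d} (hu : ‖u‖ = 1) (hz : 0 < ⟪u, z⟫) :=
    supProb_halfspace_le P hint hδ.le hu hz
  generalize (∫ x, ‖x‖ ∂P) = E at hE hlower hupper
  refine ⟨δ / (1 + E + δ), δ + E + δ / (1 + E + δ), by positivity, by linarith, 1, fun z hz => ?_⟩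
  have hz0 : 0 < ‖z‖ := by linarith
  have hu : ‖‖z‖⁻¹ • z‖ = 1 := by
    rw [norm_smul, norm_inv, norm_norm, inv_mul_cancel₀ hz0.ne']
  have huz : ⟪‖z‖⁻¹ • z, z⟫ = ‖z‖ := by
    rw [real_inner_smul_left, real_inner_self_eq_norm_sq]
    field_simp
  constructor
  · refine le_csInf ⟨_, _, hu, rfl⟩ ?_
    rintro v ⟨u, -, rfl⟩
    refine le_trans ?_ (hlower (z := z) (by simp))
    rw [← div_eq_mul_inv, div_div]
    refine div_le_div_of_nonneg_left hδ.le (by positivity) ?_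
    nlinarith
  · have hbdd : BddBelow {v : ℝ | ∃ u : Ed d, ‖u‖ = 1 ∧
        v = supProb δ P {x | 0 ≤ ⟪u, x - z⟫}} := by
      refine ⟨0, ?_⟩
      rintro v ⟨u, -, rfl⟩
      exact supProb_nonneg _ _ _
    refine (csInf_le hbdd ⟨_, hu, rfl⟩).trans ?_
    have hle := hupper hu (huz.symm ▸ hz0)
    rw [huz] at hle
    exact hle.trans (mul_le_mul_of_nonneg_right (le_add_of_nonneg_right (by positivity))
      (by positivity))
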